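/- arXiv:2201.01875 — 5 statements merged into one kernel-verified Lean document; each statement's English description precedes it below -/
import Mathlib

section
/- Let C be a chain complex of F₂-vector spaces and let τ, ι, ς : C → C be chain maps satisfying τ∘τ ≃ id, ι∘ι ≃ ς, ς∘ς ≃ id, and τ∘ι ≃ ς∘ι∘τ. Then f := τ∘ι is a homotopy self-equivalence of C, with homotopy inverse ι∘ς∘τ, and it satisfies f∘τ ≃ (ς∘τ)∘f and f∘ι ≃ (ς∘ι)∘f. Moreover, g := ς∘τ∘ι is a homotopy self-equivalence of C satisfying g∘(ς∘τ) ≃ τ∘g and g∘ι ≃ (ς∘ι)∘g. (Thus the triple (C, τ, ι) is homotopy equivalent to its twist (C, ς∘τ, ς∘ι), and (C, ς∘τ, ι) is homotopy equivalent to (C, τ, ς∘ι).) -/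
open CategoryTheory

lemma nonempty_homotopy_iff_quotient_map_eq {R : Type*} [Ring R] {ι : Type*} {c : ComplexShape ι}
    {C D : HomologicalComplex (ModuleCat R) c} (f g : C ⟶ D) :
    Nonempty (Homotopy f g) ↔
      (HomotopyCategory.quotient _ c).map f = (HomotopyCategory.quotient _ c).map g :=
  ⟨fun ⟨h⟩ => HomotopyCategory.eq_of_homotopy _ _ h,
    fun h => ⟨HomotopyCategory.homotopyOfEq _ _ h⟩⟩

/-- The identities satisfied by endomorphisms subject to the (dihedral) relations
`t ≫ t = 𝟙`, `i ≫ i = s`, `s ≫ s = 𝟙`, `i ≫ t = t ≫ i ≫ s`. -/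
lemma twist_identities {𝒞 : Type*} [Category 𝒞] {X : 𝒞} (t i s : X ⟶ X)
    (htt : t ≫ t = 𝟙 X) (hii : i ≫ i = s) (hss : s ≫ s = 𝟙 X) (hit : i ≫ t = t ≫ i ≫ s) :
    (t ≫ s ≫ i) ≫ (i ≫ t) = 𝟙 X ∧
    (i ≫ t) ≫ (t ≫ s ≫ i) = 𝟙 X ∧
    t ≫ (i ≫ t) = (i ≫ t) ≫ (t ≫ s) ∧
    i ≫ (i ≫ t) = (i ≫ t) ≫ (i ≫ s) ∧
    ((s ≫ t ≫ i ≫ s) ≫ (i ≫ t ≫ s) = 𝟙 X ∧ (i ≫ t ≫ s) ≫ (s ≫ t ≫ i ≫ s) = 𝟙 X) ∧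
    (t ≫ s) ≫ (i ≫ t ≫ s) = (i ≫ t ≫ s) ≫ t ∧
    i ≫ (i ≫ t ≫ s) = (i ≫ t ≫ s) ≫ (i ≫ s) := by
  have hsi : s ≫ i = i ≫ s := by rw [← hii, Category.assoc]
  have htt' (f : X ⟶ X) : t ≫ t ≫ f = f := by rw [← Category.assoc, htt, Category.id_comp]
  have hii' (f : X ⟶ X) : i ≫ i ≫ f = s ≫ f := by rw [← Category.assoc, hii]
  have hsi' (f : X ⟶ X) : s ≫ i ≫ f = i ≫ s ≫ f := by simp only [← Category.assoc, hsi]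
  have hit' (f : X ⟶ X) : i ≫ t ≫ f = t ≫ i ≫ s ≫ f := by
    simpa only [Category.assoc] using hit =≫ f
  have hst : s ≫ t = t ≫ s := by
    rw [← hii', hit, hit', hsi', hii', hss, Category.comp_id]
  have hst' (f : X ⟶ X) : s ≫ t ≫ f = t ≫ s ≫ f := by simp only [← Category.assoc, hst]
  simp only [Category.assoc, Category.comp_id, htt, htt', hss, hii, hii', hsi, hsi', hit,
    hit', hst', and_self]

/-- Let `C` be a chain complex of `F₂`-vector spaces and let
`τ, ι, ς : C → C` be chain maps satisfying `τ∘τ ≃ id`, `ι∘ι ≃ ς`, `ς∘ς ≃ id` and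
`τ∘ι ≃ ς∘ι∘τ`.  Then `f := τ∘ι` is a homotopy self-equivalence of `C` with homotopy
inverse `ι∘ς∘τ`, satisfying `f∘τ ≃ (ς∘τ)∘f` and `f∘ι ≃ (ς∘ι)∘f`; moreover
`g := ς∘τ∘ι` is a homotopy self-equivalence of `C` satisfying `g∘(ς∘τ) ≃ τ∘g` and
`g∘ι ≃ (ς∘ι)∘g`.  (Composition `f ≫ g` denotes `g ∘ f`, so e.g. `τ∘ι = ι ≫ τ` and
`ι∘ς∘τ = τ ≫ ς ≫ ι`.) -/
theorem twist_homotopy_equivalences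
    (C : ChainComplex (ModuleCat (ZMod 2)) ℤ) (τ ι ς : C ⟶ C)
    (hττ : Nonempty (Homotopy (τ ≫ τ) (𝟙 C)))
    (hιι : Nonempty (Homotopy (ι ≫ ι) ς))
    (hςς : Nonempty (Homotopy (ς ≫ ς) (𝟙 C)))
    (hτι : Nonempty (Homotopy (ι ≫ τ) (τ ≫ ι ≫ ς))) :
    -- `f := τ∘ι` has homotopy inverse `ι∘ς∘τ`:  `f ∘ (ι∘ς∘τ) ≃ id` …
    Nonempty (Homotopy ((τ ≫ ς ≫ ι) ≫ (ι ≫ τ)) (𝟙 C)) ∧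
    -- … and `(ι∘ς∘τ) ∘ f ≃ id`,
    Nonempty (Homotopy ((ι ≫ τ) ≫ (τ ≫ ς ≫ ι)) (𝟙 C)) ∧
    -- `f∘τ ≃ (ς∘τ)∘f`,
    Nonempty (Homotopy (τ ≫ (ι ≫ τ)) ((ι ≫ τ) ≫ (τ ≫ ς))) ∧
    -- `f∘ι ≃ (ς∘ι)∘f`,
    Nonempty (Homotopy (ι ≫ (ι ≫ τ)) ((ι ≫ τ) ≫ (ι ≫ ς))) ∧
    -- `g := ς∘τ∘ι` is a homotopy self-equivalence,
    (∃ h : C ⟶ C, Nonempty (Homotopy (h ≫ (ι ≫ τ ≫ ς)) (𝟙 C)) ∧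
        Nonempty (Homotopy ((ι ≫ τ ≫ ς) ≫ h) (𝟙 C))) ∧
    -- `g∘(ς∘τ) ≃ τ∘g`,
    Nonempty (Homotopy ((τ ≫ ς) ≫ (ι ≫ τ ≫ ς)) ((ι ≫ τ ≫ ς) ≫ τ)) ∧
    -- `g∘ι ≃ (ς∘ι)∘g`.
    Nonempty (Homotopy (ι ≫ (ι ≫ τ ≫ ς)) ((ι ≫ τ ≫ ς) ≫ (ι ≫ ς))) := by
  simp only [nonempty_homotopy_iff_quotient_map_eq, Functor.map_comp,
    CategoryTheory.Functor.map_id] at *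
  obtain ⟨h₁, h₂, h₃, h₄, h₅, h₆, h₇⟩ := twist_identities _ _ _ hττ hιι hςς hτι
  exact ⟨h₁, h₂, h₃, h₄, ⟨ς ≫ τ ≫ ι ≫ ς, by simpa only [Functor.map_comp] using h₅⟩, h₆, h₇⟩
end

section
/- For i = 1, 2 let C_i be a chain complex of F₂-vector spaces equipped with chain maps τ_i, ι_i, Φ_i, Ψ_i : C_i → C_i satisfying: Φ_i∘Φ_i ≃ 0, Ψ_i∘Ψ_i ≃ 0, Φ_i∘Ψ_i ≃ Ψ_i∘Φ_i, τ_i∘Φ_i ≃ Ψ_i∘τ_i, τ_i∘Ψ_i ≃ Φ_i∘τ_i, ι_i∘Φ_i ≃ Ψ_i∘ι_i, ι_i∘Ψ_i ≃ Φ_i∘ι_i, and τ_i∘ι_i ≃ (id + Φ_i∘Ψ_i)∘ι_i∘τ_i. On the tensor product complex C₁⊗C₂ define τ_⊗ = τ₁⊗τ₂, ι_⊗ = (id⊗id + Φ₁⊗Ψ₂)∘(ι₁⊗ι₂), Φ_⊗ = Φ₁⊗id + id⊗Φ₂, Ψ_⊗ = Ψ₁⊗id + id⊗Ψ₂, and ς_⊗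 = id⊗id + Φ_⊗∘Ψ_⊗. Then τ_⊗∘ι_⊗ ≃ ς_⊗∘ι_⊗∘τ_⊗. (This is the verification that the product of two (τ_K, ι_K)-complexes again satisfies the commutation relation between τ and ι.) -/
open TensorProduct

abbrev F2 : Type := ZMod 2

/-- Chain homotopy of maps of differential modules over `F₂` (characteristic 2, so no
signs are needed): `f ≃ g` iff `f - g = d ∘ H + H ∘ d` for some `H`. -/
def ChainHomotopic {M : Type} [AddCommGroup M] [Module F2 M]
    (d : M →ₗ[F2] M) (f g : M →ₗ[F2] M) : Prop :=
  ∃ H : M →ₗ[F2] M, f - g = d ∘ₗ H + H ∘ₗ d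

namespace ChainHomotopic

variable {M N : Type} [AddCommGroup M] [Module F2 M] [AddCommGroup N] [Module F2 N]
  {d f f' g g' h : M →ₗ[F2] M}

theorem refl (d f : M →ₗ[F2] M) : ChainHomotopic d f f :=
  ⟨0, by simp⟩

theorem symm (hf : ChainHomotopic d f g) : ChainHomotopic d g f := by
  obtain ⟨H, hH⟩ := hf
  refine ⟨-H, ?_⟩
  rw [← neg_sub, hH, LinearMap.comp_neg, LinearMap.neg_comp, neg_add]

theorem trans (hf : ChainHomotopic d f g) (hg : ChainHomotopic d g h) :
    ChainHomotopic d f h := by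
  obtain ⟨H, hH⟩ := hf
  obtain ⟨K, hK⟩ := hg
  refine ⟨H + K, ?_⟩
  rw [← sub_add_sub_cancel f g h, hH, hK, LinearMap.comp_add, LinearMap.add_comp]
  abel

theorem add (hf : ChainHomotopic d f f') (hg : ChainHomotopic d g g') :
    ChainHomotopic d (f + g) (f' + g') := by
  obtain ⟨H, hH⟩ := hf
  obtain ⟨K, hK⟩ := hg
  refine ⟨H + K, ?_⟩
  rw [add_sub_add_comm, hH, hK, LinearMap.comp_add, LinearMap.add_comp]
  abel

theorem comp_left (hg : d ∘ₗ g = g ∘ₗ d) (hf : ChainHomotopic d f f') :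
    ChainHomotopic d (g ∘ₗ f) (g ∘ₗ f') := by
  obtain ⟨H, hH⟩ := hf
  refine ⟨g ∘ₗ H, ?_⟩
  rw [← LinearMap.comp_sub, hH, LinearMap.comp_add, ← LinearMap.comp_assoc H g d, hg]
  simp only [LinearMap.comp_assoc]

theorem comp_right (hg : d ∘ₗ g = g ∘ₗ d) (hf : ChainHomotopic d f f') :
    ChainHomotopic d (f ∘ₗ g) (f' ∘ₗ g) := by
  obtain ⟨H, hH⟩ := hf
  refine ⟨H ∘ₗ g, ?_⟩
  rw [← LinearMap.sub_comp, hH, LinearMap.add_comp]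
  simp only [LinearMap.comp_assoc, hg]

theorem map_left {e k : N →ₗ[F2] N} (hk : e ∘ₗ k = k ∘ₗ e) (hf : ChainHomotopic d f f') :
    ChainHomotopic (map d LinearMap.id + map LinearMap.id e) (map f k) (map f' k) := by
  obtain ⟨H, hH⟩ := hf
  refine ⟨map H k, ?_⟩
  rw [sub_eq_iff_eq_add] at hH
  rw [hH]
  simp only [LinearMap.add_comp, LinearMap.comp_add, ← map_comp, LinearMap.id_comp,
    LinearMap.comp_id, map_add_left, hk]
  rw [add_sub_cancel_right, add_add_add_comm, add_comm (map H (k ∘ₗ e)), add_assoc,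
    ZModModule.add_self, add_zero]

theorem map_right {e k : N →ₗ[F2] N} (hk : e ∘ₗ k = k ∘ₗ e) (hf : ChainHomotopic d f f') :
    ChainHomotopic (map e LinearMap.id + map LinearMap.id d) (map k f) (map k f') := by
  obtain ⟨H, hH⟩ := hf
  refine ⟨map k H, ?_⟩
  rw [sub_eq_iff_eq_add] at hH
  rw [hH]
  simp only [LinearMap.add_comp, LinearMap.comp_add, ← map_comp, LinearMap.id_comp,
    LinearMap.comp_id, map_add_right, hk]
  rw [add_sub_cancel_right, add_add_add_comm, ZModModule.add_self, zero_add]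

theorem tensor {e k k' : N →ₗ[F2] N} (hf' : d ∘ₗ f' = f' ∘ₗ d) (hk : e ∘ₗ k = k ∘ₗ e)
    (hf : ChainHomotopic d f f') (hkk' : ChainHomotopic e k k') :
    ChainHomotopic (map d LinearMap.id + map LinearMap.id e) (map f k) (map f' k') :=
  (hf.map_left hk).trans (hkk'.map_right hf')

end ChainHomotopic

theorem LinearMap.comp_comm_of_comm {R M : Type*} [Semiring R] [AddCommMonoid M] [Module R M]
    {d f g : M →ₗ[R] M} (hf : d ∘ₗ f = f ∘ₗ d) (hg : d ∘ₗ g = g ∘ₗ d) :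
    d ∘ₗ (f ∘ₗ g) = (f ∘ₗ g) ∘ₗ d :=
  Commute.mul_right (a := d) (b := f) (c := g) hf hg

/-- If `τ` intertwines `P` and `Q` up to homotopy, where `Q ∘ Φ ∘ Ψ` is null-homotopic and
`τ ∘ ι ≃ (id + Φ ∘ Ψ) ∘ ι ∘ τ`, then `τ ∘ P ∘ ι ≃ Q ∘ ι ∘ τ`. -/
theorem ChainHomotopic.comp_comp_of_null {M : Type} [AddCommGroup M] [Module F2 M]
    {d τ ι Φ Ψ P Q : M →ₗ[F2] M}
    (hτ : d ∘ₗ τ = τ ∘ₗ d) (hι : d ∘ₗ ι = ι ∘ₗ d) (hQ : d ∘ₗ Q = Q ∘ₗ d)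
    (hPQ : ChainHomotopic d (τ ∘ₗ P) (Q ∘ₗ τ))
    (hnull : ChainHomotopic d (Q ∘ₗ Φ ∘ₗ Ψ) 0)
    (hτι : ChainHomotopic d (τ ∘ₗ ι) ((LinearMap.id + Φ ∘ₗ Ψ) ∘ₗ ι ∘ₗ τ)) :
    ChainHomotopic d (τ ∘ₗ P ∘ₗ ι) (Q ∘ₗ ι ∘ₗ τ) := by
  have h₁ := hPQ.comp_right hι
  have h₂ := hτι.comp_left hQ
  have h₃ := (ChainHomotopic.refl d (Q ∘ₗ ι ∘ₗ τ)).add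
    (hnull.comp_right (LinearMap.comp_comm_of_comm hι hτ))
  simp only [LinearMap.add_comp, LinearMap.comp_add, LinearMap.id_comp, LinearMap.comp_assoc,
    LinearMap.zero_comp, add_zero] at h₁ h₂ h₃
  exact h₁.trans (h₂.trans h₃)

/-- For `i = 1,2` let `C_i` be a chain complex of `F₂`-vector spaces with
chain maps `τ_i, ι_i, Φ_i, Ψ_i` satisfying the listed homotopy relations.  On the tensor
product complex `C₁ ⊗ C₂` (differential `∂⊗id + id⊗∂`) define `τ_⊗ = τ₁⊗τ₂`,
`ι_⊗ = (id⊗id + Φ₁⊗Ψ₂)∘(ι₁⊗ι₂)`, `Φ_⊗ = Φ₁⊗id + id⊗Φ₂`, `Ψ_⊗ = Ψ₁⊗id + id⊗Ψ₂` and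
`ς_⊗ = id⊗id + Φ_⊗∘Ψ_⊗`.  Then `τ_⊗ ∘ ι_⊗ ≃ ς_⊗ ∘ ι_⊗ ∘ τ_⊗`. -/
theorem product_commutation_relation
    {M₁ M₂ : Type} [AddCommGroup M₁] [Module F2 M₁] [AddCommGroup M₂] [Module F2 M₂]
    (d₁ τ₁ ι₁ Φ₁ Ψ₁ : M₁ →ₗ[F2] M₁) (d₂ τ₂ ι₂ Φ₂ Ψ₂ : M₂ →ₗ[F2] M₂)
    (hd₁ : d₁ ∘ₗ d₁ = 0) (hd₂ : d₂ ∘ₗ d₂ = 0)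
    -- all eight maps are chain maps:
    (hτd₁ : d₁ ∘ₗ τ₁ = τ₁ ∘ₗ d₁) (hιd₁ : d₁ ∘ₗ ι₁ = ι₁ ∘ₗ d₁)
    (hΦd₁ : d₁ ∘ₗ Φ₁ = Φ₁ ∘ₗ d₁) (hΨd₁ : d₁ ∘ₗ Ψ₁ = Ψ₁ ∘ₗ d₁)
    (hτd₂ : d₂ ∘ₗ τ₂ = τ₂ ∘ₗ d₂) (hιd₂ : d₂ ∘ₗ ι₂ = ι₂ ∘ₗ d₂)
    (hΦd₂ : d₂ ∘ₗ Φ₂ = Φ₂ ∘ₗ d₂) (hΨd₂ : d₂ ∘ₗ Ψ₂ = Ψ₂ ∘ₗ d₂)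
    -- the homotopy relations in the first factor:
    (hΦΦ₁ : ChainHomotopic d₁ (Φ₁ ∘ₗ Φ₁) 0) (hΨΨ₁ : ChainHomotopic d₁ (Ψ₁ ∘ₗ Ψ₁) 0)
    (hΦΨ₁ : ChainHomotopic d₁ (Φ₁ ∘ₗ Ψ₁) (Ψ₁ ∘ₗ Φ₁))
    (hτΦ₁ : ChainHomotopic d₁ (τ₁ ∘ₗ Φ₁) (Ψ₁ ∘ₗ τ₁))
    (hτΨ₁ : ChainHomotopic d₁ (τ₁ ∘ₗ Ψ₁) (Φ₁ ∘ₗ τ₁))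
    (hιΦ₁ : ChainHomotopic d₁ (ι₁ ∘ₗ Φ₁) (Ψ₁ ∘ₗ ι₁))
    (hιΨ₁ : ChainHomotopic d₁ (ι₁ ∘ₗ Ψ₁) (Φ₁ ∘ₗ ι₁))
    (hτι₁ : ChainHomotopic d₁ (τ₁ ∘ₗ ι₁) ((LinearMap.id + Φ₁ ∘ₗ Ψ₁) ∘ₗ ι₁ ∘ₗ τ₁))
    -- the homotopy relations in the second factor:
    (hΦΦ₂ : ChainHomotopic d₂ (Φ₂ ∘ₗ Φ₂) 0) (hΨΨ₂ : ChainHomotopic d₂ (Ψ₂ ∘ₗ Ψ₂) 0)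
    (hΦΨ₂ : ChainHomotopic d₂ (Φ₂ ∘ₗ Ψ₂) (Ψ₂ ∘ₗ Φ₂))
    (hτΦ₂ : ChainHomotopic d₂ (τ₂ ∘ₗ Φ₂) (Ψ₂ ∘ₗ τ₂))
    (hτΨ₂ : ChainHomotopic d₂ (τ₂ ∘ₗ Ψ₂) (Φ₂ ∘ₗ τ₂))
    (hιΦ₂ : ChainHomotopic d₂ (ι₂ ∘ₗ Φ₂) (Ψ₂ ∘ₗ ι₂))
    (hιΨ₂ : ChainHomotopic d₂ (ι₂ ∘ₗ Ψ₂) (Φ₂ ∘ₗ ι₂))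
    (hτι₂ : ChainHomotopic d₂ (τ₂ ∘ₗ ι₂) ((LinearMap.id + Φ₂ ∘ₗ Ψ₂) ∘ₗ ι₂ ∘ₗ τ₂)) :
    ChainHomotopic
      (map d₁ LinearMap.id + map LinearMap.id d₂)
      ((map τ₁ τ₂) ∘ₗ ((LinearMap.id + map Φ₁ Ψ₂) ∘ₗ map ι₁ ι₂))
      ((LinearMap.id +
          (map Φ₁ LinearMap.id + map LinearMap.id Φ₂) ∘ₗ
            (map Ψ₁ LinearMap.id + map LinearMap.id Ψ₂)) ∘ₗ
        ((LinearMap.id + map Φ₁ Ψ₂) ∘ₗ map ι₁ ι₂) ∘ₗ (map τ₁ τ₂)) := by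
  have hA : d₁ ∘ₗ (ι₁ ∘ₗ τ₁) = (ι₁ ∘ₗ τ₁) ∘ₗ d₁ := LinearMap.comp_comm_of_comm hιd₁ hτd₁
  have hB : d₂ ∘ₗ (ι₂ ∘ₗ τ₂) = (ι₂ ∘ₗ τ₂) ∘ₗ d₂ := LinearMap.comp_comm_of_comm hιd₂ hτd₂
  have hΨΦΨ₁ : ChainHomotopic d₁ (Ψ₁ ∘ₗ Φ₁ ∘ₗ Ψ₁) 0 := by
    have h := hΦΨ₁.symm.comp_right hΨd₁
    have h' := hΨΨ₁.comp_left hΦd₁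
    rw [LinearMap.comp_zero] at h'
    exact h.trans h'
  have hΦΦΨ₂ : ChainHomotopic d₂ (Φ₂ ∘ₗ Φ₂ ∘ₗ Ψ₂) 0 := by
    simpa only [LinearMap.zero_comp, LinearMap.comp_assoc] using hΦΦ₂.comp_right hΨd₂
  have hΦΨΦ₁ : ChainHomotopic d₁ (Φ₁ ∘ₗ Ψ₁ ∘ₗ Φ₁) 0 := by
    have h := hΦΨ₁.comp_right hΦd₁
    have h' := hΦΦ₁.comp_left hΨd₁
    rw [LinearMap.comp_zero] at h'
    exact h.trans h'
  have hΦΨΨ₂ : ChainHomotopic d₂ (Φ₂ ∘ₗ Ψ₂ ∘ₗ Ψ₂) 0 := by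
    simpa only [LinearMap.comp_zero] using hΨΨ₂.comp_left hΦd₂
  have hX := LinearMap.comp_comm_of_comm
    (by rw [LinearMap.comp_add, LinearMap.add_comp, LinearMap.comp_comm_of_comm hΦd₁ hΨd₁,
      LinearMap.comp_id, LinearMap.id_comp] :
      d₁ ∘ₗ (LinearMap.id + Φ₁ ∘ₗ Ψ₁) = (LinearMap.id + Φ₁ ∘ₗ Ψ₁) ∘ₗ d₁) hA
  have hL := (ChainHomotopic.tensor hX (LinearMap.comp_comm_of_comm hτd₂ hιd₂) hτι₁ hτι₂).add
    (ChainHomotopic.tensor (LinearMap.comp_comm_of_comm hΨd₁ hA)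
      (LinearMap.comp_comm_of_comm hτd₂ (LinearMap.comp_comm_of_comm hΨd₂ hιd₂))
      (hτΦ₁.comp_comp_of_null hτd₁ hιd₁ hΨd₁ hΨΦΨ₁ hτι₁)
      (hτΨ₂.comp_comp_of_null hτd₂ hιd₂ hΦd₂ hΦΦΨ₂ hτι₂))
  -- the terms of the expanded right-hand side that vanish or have to be reordered
  have h₁ := (hΦΨΦ₁.comp_right hA).map_left (LinearMap.comp_comm_of_comm hΨd₂ hB)
  have h₂ := (hΦΦ₁.comp_right hA).map_left
    (LinearMap.comp_comm_of_comm hΨd₂ (LinearMap.comp_comm_of_comm hΨd₂ hB))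
  have h₃ := (hΦΨΨ₂.comp_right hB).map_right (LinearMap.comp_comm_of_comm hΦd₁ hA)
  have h₄ := (hΦΨ₁.symm.comp_right hA).map_left
    (LinearMap.comp_comm_of_comm hΦd₂ (LinearMap.comp_comm_of_comm hΨd₂ hB))
  have hR := (ChainHomotopic.refl (map d₁ LinearMap.id + map LinearMap.id d₂)
    (map (ι₁ ∘ₗ τ₁) (ι₂ ∘ₗ τ₂) + map (Φ₁ ∘ₗ Ψ₁ ∘ₗ ι₁ ∘ₗ τ₁) (ι₂ ∘ₗ τ₂)
      + map (ι₁ ∘ₗ τ₁) (Φ₂ ∘ₗ Ψ₂ ∘ₗ ι₂ ∘ₗ τ₂)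
      + map (Ψ₁ ∘ₗ ι₁ ∘ₗ τ₁) (Φ₂ ∘ₗ ι₂ ∘ₗ τ₂))).add (((h₁.add h₂).add h₃).add h₄)
  convert hL.trans (ChainHomotopic.trans ?_ hR.symm) using 1
  · simp only [LinearMap.add_comp, LinearMap.comp_add, ← map_comp, LinearMap.id_comp]
  · simp only [LinearMap.add_comp, LinearMap.comp_add, ← map_comp, LinearMap.id_comp,
      LinearMap.comp_id, LinearMap.comp_assoc]
    have hz := ZModModule.add_self (map (Φ₁ ∘ₗ ι₁ ∘ₗ τ₁) (Ψ₂ ∘ₗ ι₂ ∘ₗ τ₂))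
    rw [← sub_eq_zero, ← hz]
    abel
  · convert ChainHomotopic.refl _ _ using 1
    simp only [LinearMap.add_comp, LinearMap.id_comp, LinearMap.comp_assoc, map_add_left,
      map_add_right, LinearMap.zero_comp, map_zero_left, map_zero_right]
    abel
end

section
/- For every integer n ≥ 1, the map τ_E on E_n is a skew-graded, skew-equivariant chain map (τ_E∘∂ = ∂∘τ_E) and satisfies τ_E∘τ_E = id. -/
open Finsupp

/-- The ring `R = F₂[U,V]`: `U = X 0`, `V = X 1`. -/
abbrev R2 : Type := MvPolynomial (Fin 2) F2

noncomputable def UU : R2 := MvPolynomial.X 0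
noncomputable def VV : R2 := MvPolynomial.X 1

/-- The involution of `R = F₂[U,V]` exchanging `U` and `V`. -/
noncomputable def swUV : R2 →+* R2 :=
  (MvPolynomial.rename (Equiv.swap (0 : Fin 2) 1)).toRingHom

/-- The skew-equivariant (i.e. semilinear over `swUV`) extension of a map defined on
the basis elements of a free `R`-module. -/
noncomputable def skewExt {β γ : Type} (f : β → (γ →₀ R2)) :
    (β →₀ R2) → (γ →₀ R2) :=
  fun ξ => Finsupp.linearCombination R2 f (ξ.mapRange (swUV ·) (map_zero _))

/-- `ξ` is homogeneous of bidegree `deg` in the free bigraded `R`-module with basis `β`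
and bigrading `g` on the basis elements. -/
def Homog {β : Type} (g : β → ℤ × ℤ) (deg : ℤ × ℤ) (ξ : β →₀ R2) : Prop :=
  ∀ b ∈ ξ.support, ∀ m ∈ (ξ b).support,
    (g b).1 - 2 * (m 0 : ℤ) = deg.1 ∧ (g b).2 - 2 * (m 1 : ℤ) = deg.2

/-! The staircase complex `D_n` has basis `{w_k : k odd, |k| ≤ 4n−3}` and
`{z_ℓ : ℓ even, |ℓ| ≤ 4n−2}` with `∂w_k = V^{⌈(k+4n−1)/4⌉} z_{k−1} +
U^{⌈(4n−1−k)/4⌉} z_{k+1}` and `∂z_ℓ = 0` (note `⌈m/4⌉ = ⌊(m+3)/4⌋`);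
the square complex `S_n` has basis `{r₀, r₋₁, r₁, t}` with `∂r₀ = Vⁿ r₋₁ + Uⁿ r₁`,
`∂r₋₁ = Uⁿ t`, `∂r₁ = Vⁿ t`, `∂t = 0`; and `E_n = D_n ⊕ S_n`. -/

abbrev WIdx (n : ℤ) := {k : ℤ // k % 2 = 1 ∧ -(4*n - 3) ≤ k ∧ k ≤ 4*n - 3}
abbrev ZIdx (n : ℤ) := {l : ℤ // l % 2 = 0 ∧ -(4*n - 2) ≤ l ∧ l ≤ 4*n - 2}
abbrev DBs (n : ℤ) := WIdx n ⊕ ZIdx n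

/-- Basis of the square complex `S_n`: `r₀, r₋₁, r₁, t`. -/
inductive SB : Type | r0 : SB | rm : SB | rp : SB | t : SB

/-- Basis of `E_n = D_n ⊕ S_n`. -/
abbrev EB (n : ℤ) := DBs n ⊕ SB

/-- The underlying module of `E_n`. -/
abbrev Ec (n : ℤ) := EB n →₀ R2

/-- The generator `w_k` of `E_n` (interpreted as `0` for out-of-range `k`). -/
noncomputable def wE (n k : ℤ) : Ec n :=
  if h : k % 2 = 1 ∧ -(4*n - 3) ≤ k ∧ k ≤ 4*n - 3 then single (.inl (.inl ⟨k, h⟩)) 1 else 0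

/-- The generator `z_ℓ` of `E_n` (interpreted as `0` for out-of-range `ℓ`). -/
noncomputable def zE (n l : ℤ) : Ec n :=
  if h : l % 2 = 0 ∧ -(4*n - 2) ≤ l ∧ l ≤ 4*n - 2 then single (.inl (.inr ⟨l, h⟩)) 1 else 0

/-- The generators `r₀, r₋₁, r₁, t` of `E_n`. -/
noncomputable def sE (n : ℤ) (s : SB) : Ec n := single (.inr s) 1

/-- The differential of `E_n = D_n ⊕ S_n`. -/
noncomputable def dE (n : ℤ) : Ec n →ₗ[R2] Ec n :=
  linearCombination R2 fun b => match b with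
  | .inl (.inl ⟨k, _⟩) =>
      VV ^ (((k + 4*n + 2)/4).toNat) • zE n (k - 1) +
        UU ^ (((4*n + 2 - k)/4).toNat) • zE n (k + 1)
  | .inl (.inr _) => 0
  | .inr SB.r0 => VV ^ n.toNat • sE n SB.rm + UU ^ n.toNat • sE n SB.rp
  | .inr SB.rm => UU ^ n.toNat • sE n SB.t
  | .inr SB.rp => VV ^ n.toNat • sE n SB.t
  | .inr SB.t => 0

/-- The map `τ_E` of `E_n`: the skew-equivariant map determined by
`τ_E(w_k) = w_{−k}` for `k ≠ ±1`, `τ_E(w₋₁) = w₁ + r₁`, `τ_E(w₁) = w₋₁ + r₋₁`,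
`τ_E(z_ℓ) = z_{−ℓ}` for `ℓ ≠ 0`, `τ_E(z₀) = z₀ + t`, `τ_E(r₀) = r₀`,
`τ_E(r₋₁) = r₁`, `τ_E(r₁) = r₋₁`, `τ_E(t) = t`. -/
noncomputable def τE (n : ℤ) : Ec n → Ec n :=
  skewExt fun b => match b with
  | .inl (.inl ⟨k, _⟩) =>
      if k = -1 then wE n 1 + sE n SB.rp
      else if k = 1 then wE n (-1) + sE n SB.rm
      else wE n (-k)
  | .inl (.inr ⟨l, _⟩) => if l = 0 then zE n 0 + sE n SB.t else zE n (-l)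
  | .inr SB.r0 => sE n SB.r0
  | .inr SB.rm => sE n SB.rp
  | .inr SB.rp => sE n SB.rm
  | .inr SB.t => sE n SB.t

/-- The defining conditions on the bigrading of `D_n` (the differential has bidegree
`(−1,−1)`, `U` has bidegree `(−2,0)`, `V` has bidegree `(0,−2)`, and
`gr_V(z_{−4n+2}) = gr_U(z_{4n−2}) = 0`). -/
def IsDGrading (n : ℤ) (gw gz : ℤ → ℤ × ℤ) : Prop :=
  (gz (-(4*n) + 2)).2 = 0 ∧ (gz (4*n - 2)).1 = 0 ∧
  ∀ k : ℤ, k % 2 = 1 → -(4*n - 3) ≤ k → k ≤ 4*n - 3 →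
    gz (k - 1) = ((gw k).1 - 1, (gw k).2 - 1 + 2*((k + 4*n + 2)/4)) ∧
    gz (k + 1) = ((gw k).1 - 1 + 2*((4*n + 2 - k)/4), (gw k).2 - 1)

/-- The defining conditions on the bigrading of `S_n`: the differential has bidegree
`(−1,−1)` and `gr(t) = gr(z₀)`. -/
def IsSGrading (n : ℤ) (gz : ℤ → ℤ × ℤ) (gS : SB → ℤ × ℤ) : Prop :=
  gS SB.t = gz 0 ∧
  (gS SB.rm).1 - 1 = (gS SB.t).1 - 2*n ∧ (gS SB.rm).2 - 1 = (gS SB.t).2 ∧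
  (gS SB.rp).1 - 1 = (gS SB.t).1 ∧ (gS SB.rp).2 - 1 = (gS SB.t).2 - 2*n ∧
  (gS SB.r0).1 - 1 = (gS SB.rm).1 ∧ (gS SB.r0).2 - 1 = (gS SB.rm).2 - 2*n ∧
  (gS SB.r0).1 - 1 = (gS SB.rp).1 - 2*n ∧ (gS SB.r0).2 - 1 = (gS SB.rp).2

/-- The bigrading of `E_n = D_n ⊕ S_n` assembled from those of `D_n` and `S_n`. -/
def grE (gw gz : ℤ → ℤ × ℤ) (gS : SB → ℤ × ℤ) {n : ℤ} : EB n → ℤ × ℤ := fun b =>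
  match b with
  | .inl (.inl ⟨k, _⟩) => gw k
  | .inl (.inr ⟨l, _⟩) => gz l
  | .inr s => gS s

section SkewExtension

variable {β γ : Type}

lemma swUV_swUV (p : R2) : swUV (swUV p) = p := by
  change MvPolynomial.rename _ (MvPolynomial.rename _ p) = p
  rw [MvPolynomial.rename_rename]
  have h : (Equiv.swap (0 : Fin 2) 1 ∘ Equiv.swap (0 : Fin 2) 1 : Fin 2 → Fin 2) = id := by
    ext i; simp
  rw [h, MvPolynomial.rename_id_apply]

lemma swUV_UU : swUV UU = VV := by
  change MvPolynomial.rename _ (MvPolynomial.X 0) = MvPolynomial.X 1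
  simp

lemma swUV_VV : swUV VV = UU := by
  change MvPolynomial.rename _ (MvPolynomial.X 1) = MvPolynomial.X 0
  simp

/-- The support of `swUV p` is that of `p` with the exponents exchanged. -/
lemma exists_mem_support_of_mem_support_swUV {p : R2} {m : Fin 2 →₀ ℕ}
    (hm : m ∈ (swUV p).support) : ∃ m' ∈ p.support, m 0 = m' 1 ∧ m 1 = m' 0 := by
  change m ∈ (MvPolynomial.rename _ p).support at hm
  rw [MvPolynomial.support_rename_of_injective (Equiv.injective _)] at hm
  obtain ⟨m', hm', rfl⟩ := Finset.mem_image.mp hm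
  refine ⟨m', hm', ?_, ?_⟩
  · simp
  · simp

lemma skewExt_add (f : β → (γ →₀ R2)) (ξ η : β →₀ R2) :
    skewExt f (ξ + η) = skewExt f ξ + skewExt f η := by
  unfold skewExt
  rw [Finsupp.mapRange_add (fun a b => map_add swUV a b), map_add]

lemma skewExt_zero (f : β → (γ →₀ R2)) : skewExt f 0 = 0 := by
  simp [skewExt]

lemma skewExt_smul (f : β → (γ →₀ R2)) (p : R2) (ξ : β →₀ R2) :
    skewExt f (p • ξ) = swUV p • skewExt f ξ := by
  unfold skewExt
  rw [← map_smul]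
  congr 1
  ext b : 1
  simp

lemma skewExt_single (f : β → (γ →₀ R2)) (b : β) (p : R2) :
    skewExt f (single b p) = swUV p • f b := by
  simp [skewExt]

lemma Homog.zero (g : β → ℤ × ℤ) (d : ℤ × ℤ) : Homog g d 0 := by
  intro b hb; simp at hb

lemma Homog.add {g : β → ℤ × ℤ} {d : ℤ × ℤ} {ξ η : β →₀ R2}
    (hξ : Homog g d ξ) (hη : Homog g d η) : Homog g d (ξ + η) := by
  classical
  intro b _ m hm
  rw [Finsupp.add_apply] at hm
  rcases Finset.mem_union.mp (MvPolynomial.support_add hm) with h | h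
  · exact hξ b (by rw [Finsupp.mem_support_iff]; intro h0; simp [h0] at h) m h
  · exact hη b (by rw [Finsupp.mem_support_iff]; intro h0; simp [h0] at h) m h

lemma Homog.single_one {g : β → ℤ × ℤ} {d : ℤ × ℤ} {b : β} (h : g b = d) :
    Homog g d (single b 1) := by
  classical
  intro c hc m hm
  obtain rfl : c = b := by
    by_contra hcb
    exact hcb (by simpa using hc)
  have hm0 : m = 0 := by
    rw [Finsupp.single_eq_same] at hm
    simpa using hm
  simp [hm0, h]

lemma Homog.smul {g : β → ℤ × ℤ} {d e : ℤ × ℤ} {q : R2} {ξ : β →₀ R2}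
    (hq : ∀ m ∈ q.support, d.1 - 2 * (m 0 : ℤ) = e.1 ∧ d.2 - 2 * (m 1 : ℤ) = e.2)
    (hξ : Homog g d ξ) : Homog g e (q • ξ) := by
  classical
  intro b _ m hm
  rw [Finsupp.smul_apply, smul_eq_mul] at hm
  obtain ⟨m₁, h₁, m₂, h₂, rfl⟩ := Finset.mem_add.mp (MvPolynomial.support_mul _ _ hm)
  have hb := hξ b (by rw [Finsupp.mem_support_iff]; intro h0; simp [h0] at h₂) m₂ h₂
  have := hq m₁ h₁
  simp only [Finsupp.add_apply, Nat.cast_add]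
  constructor <;> linarith [hb.1, hb.2, this.1, this.2]

/-- A skew-equivariant extension is skew-graded as soon as it is so on the basis. -/
lemma homog_skewExt {g : β → ℤ × ℤ} {g' : γ → ℤ × ℤ} {f : β → (γ →₀ R2)}
    (hf : ∀ b, Homog g' (g b).swap (f b)) {d : ℤ × ℤ} {ξ : β →₀ R2} (hξ : Homog g d ξ) :
    Homog g' d.swap (skewExt f ξ) := by
  classical
  have hsum : skewExt f ξ = ∑ b ∈ ξ.support, swUV (ξ b) • f b := by
    unfold skewExt
    rw [Finsupp.linearCombination_apply, Finsupp.sum_of_support_subset _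
      Finsupp.support_mapRange _ (by simp)]
    simp
  rw [hsum]
  refine Finset.sum_induction _ (Homog g' d.swap) (fun _ _ => Homog.add) (Homog.zero _ _) ?_
  intro b hb
  refine Homog.smul (fun m hm => ?_) (hf b)
  obtain ⟨m', hm', h0, h1⟩ := exists_mem_support_of_mem_support_swUV hm
  have := hξ b hb m' hm'
  rw [h0, h1]
  exact ⟨this.2, this.1⟩

end SkewExtension

section TauE

variable {n : ℤ}

lemma τE_add (ξ η : Ec n) : τE n (ξ + η) = τE n ξ + τE n η := skewExt_add _ _ _

lemma τE_zero : τE n 0 = 0 := skewExt_zero _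

lemma τE_smul (p : R2) (ξ : Ec n) : τE n (p • ξ) = swUV p • τE n ξ := skewExt_smul _ _ _

lemma τE_wE_neg_one (hn : 1 ≤ n) : τE n (wE n (-1)) = wE n 1 + sE n SB.rp := by
  rw [wE, dif_pos (by omega), τE, skewExt_single]
  simp

lemma τE_wE_one (hn : 1 ≤ n) : τE n (wE n 1) = wE n (-1) + sE n SB.rm := by
  rw [wE, dif_pos (by omega), τE, skewExt_single]
  simp

lemma τE_wE {k : ℤ} (h₁ : k ≠ -1) (h₂ : k ≠ 1) : τE n (wE n k) = wE n (-k) := by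
  by_cases h : k % 2 = 1 ∧ -(4*n - 3) ≤ k ∧ k ≤ 4*n - 3
  · rw [wE, dif_pos h, τE, skewExt_single]
    simp [h₁, h₂]
  · rw [wE, wE, dif_neg h, dif_neg (by omega), τE_zero]

lemma τE_zE_zero (hn : 1 ≤ n) : τE n (zE n 0) = zE n 0 + sE n SB.t := by
  conv_lhs => rw [zE, dif_pos (by omega), τE, skewExt_single]
  simp

lemma τE_zE {l : ℤ} (h₀ : l ≠ 0) : τE n (zE n l) = zE n (-l) := by
  by_cases h : l % 2 = 0 ∧ -(4*n - 2) ≤ l ∧ l ≤ 4*n - 2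
  · rw [zE, dif_pos h, τE, skewExt_single]
    simp [h₀]
  · rw [zE, zE, dif_neg h, dif_neg (by omega), τE_zero]

lemma τE_sE_r0 : τE n (sE n SB.r0) = sE n SB.r0 := by
  conv_lhs => rw [sE, τE, skewExt_single]
  simp

lemma τE_sE_rm : τE n (sE n SB.rm) = sE n SB.rp := by
  conv_lhs => rw [sE, τE, skewExt_single]
  simp

lemma τE_sE_rp : τE n (sE n SB.rp) = sE n SB.rm := by
  conv_lhs => rw [sE, τE, skewExt_single]
  simp

lemma τE_sE_t : τE n (sE n SB.t) = sE n SB.t := by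
  conv_lhs => rw [sE, τE, skewExt_single]
  simp

lemma dE_wE {k : ℤ} (h : k % 2 = 1 ∧ -(4*n - 3) ≤ k ∧ k ≤ 4*n - 3) :
    dE n (wE n k) = VV ^ (((k + 4*n + 2)/4).toNat) • zE n (k - 1) +
        UU ^ (((4*n + 2 - k)/4).toNat) • zE n (k + 1) := by
  rw [wE, dif_pos h, dE, linearCombination_single, one_smul]

lemma dE_zE (l : ℤ) : dE n (zE n l) = 0 := by
  by_cases h : l % 2 = 0 ∧ -(4*n - 2) ≤ l ∧ l ≤ 4*n - 2
  · rw [zE, dif_pos h, dE, linearCombination_single, one_smul]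
  · rw [zE, dif_neg h, map_zero]

lemma dE_sE_r0 :
    dE n (sE n SB.r0) = VV ^ n.toNat • sE n SB.rm + UU ^ n.toNat • sE n SB.rp := by
  conv_lhs => rw [sE, dE, linearCombination_single, one_smul]

lemma dE_sE_rm : dE n (sE n SB.rm) = UU ^ n.toNat • sE n SB.t := by
  conv_lhs => rw [sE, dE, linearCombination_single, one_smul]

lemma dE_sE_rp : dE n (sE n SB.rp) = VV ^ n.toNat • sE n SB.t := by
  conv_lhs => rw [sE, dE, linearCombination_single, one_smul]

lemma dE_sE_t : dE n (sE n SB.t) = 0 := by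
  rw [sE, dE, linearCombination_single, one_smul]

/-- Induction principle for elements of `E_n`, in terms of the named generators. -/
lemma Ec.induction {P : Ec n → Prop} (h0 : P 0) (hadd : ∀ ξ η, P ξ → P η → P (ξ + η))
    (hsmul : ∀ (p : R2) (ξ), P ξ → P (p • ξ))
    (hw : ∀ k, k % 2 = 1 ∧ -(4*n - 3) ≤ k ∧ k ≤ 4*n - 3 → P (wE n k))
    (hz : ∀ l, l % 2 = 0 ∧ -(4*n - 2) ≤ l ∧ l ≤ 4*n - 2 → P (zE n l))
    (hs : ∀ s, P (sE n s)) (ξ : Ec n) : P ξ := by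
  induction ξ using Finsupp.induction_linear with
  | zero => exact h0
  | add ξ η hξ hη => exact hadd ξ η hξ hη
  | single b p =>
    have hp : (single b p : Ec n) = p • single b 1 := by simp
    rw [hp]
    apply hsmul
    rcases b with (⟨k, hk⟩ | ⟨l, hl⟩) | s
    · simpa only [wE, dif_pos hk] using hw k hk
    · simpa only [zE, dif_pos hl] using hz l hl
    · exact hs s

lemma Ec.add_self_cancel (ξ η : Ec n) : ξ + η + η = ξ := by
  have : η + η = 0 := by
    rw [← two_smul R2, show (2 : R2) = 0 from CharTwo.two_eq_zero, zero_smul]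
  rw [add_assoc, this, add_zero]

lemma τE_τE (hn : 1 ≤ n) (ξ : Ec n) : τE n (τE n ξ) = ξ := by
  induction ξ using Ec.induction with
  | h0 => simp only [τE_zero]
  | hadd ξ η hξ hη => simp only [τE_add, hξ, hη]
  | hsmul p ξ hξ => simp only [τE_smul, hξ, swUV_swUV]
  | hw k hk =>
    by_cases h₁ : k = -1
    · subst h₁
      rw [τE_wE_neg_one hn, τE_add, τE_wE_one hn, τE_sE_rp, Ec.add_self_cancel]
    by_cases h₂ : k = 1
    · subst h₂
      rw [τE_wE_one hn, τE_add, τE_wE_neg_one hn, τE_sE_rm, Ec.add_self_cancel]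
    rw [τE_wE h₁ h₂, τE_wE (by omega) (by omega), neg_neg]
  | hz l hl =>
    by_cases h₀ : l = 0
    · subst h₀
      rw [τE_zE_zero hn, τE_add, τE_zE_zero hn, τE_sE_t, Ec.add_self_cancel]
    rw [τE_zE h₀, τE_zE (by omega), neg_neg]
  | hs s => cases s <;> simp only [τE_sE_r0, τE_sE_rm, τE_sE_rp, τE_sE_t]

lemma τE_dE (hn : 1 ≤ n) (ξ : Ec n) : τE n (dE n ξ) = dE n (τE n ξ) := by
  induction ξ using Ec.induction with
  | h0 => simp only [map_zero, τE_zero]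
  | hadd ξ η hξ hη => simp only [map_add, τE_add, hξ, hη]
  | hsmul p ξ hξ => simp only [map_smul, τE_smul, hξ]
  | hw k hk =>
    rw [dE_wE hk, τE_add, τE_smul, τE_smul, map_pow, map_pow, swUV_UU, swUV_VV]
    by_cases h₁ : k = -1
    · subst h₁
      rw [τE_wE_neg_one hn, map_add, dE_wE (by omega), dE_sE_rp, τE_zE (by omega),
        show (-1 : ℤ) + 1 = 0 by norm_num, τE_zE_zero hn, show (1 : ℤ) - 1 = 0 by norm_num,
        show -((-1 : ℤ) - 1) = 1 + 1 by norm_num,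
        show (-1 + 4*n + 2)/4 = n by omega, show (4*n + 2 - -1)/4 = n by omega,
        show (1 + 4*n + 2)/4 = n by omega, show (4*n + 2 - 1)/4 = n by omega, smul_add]
      abel
    by_cases h₂ : k = 1
    · subst h₂
      rw [τE_wE_one hn, map_add, dE_wE (by omega), dE_sE_rm, τE_zE (l := 1 + 1) (by omega),
        show (-1 : ℤ) + 1 = 0 by norm_num, show (1 : ℤ) - 1 = 0 by norm_num, τE_zE_zero hn,
        show (-1 : ℤ) - 1 = -(1 + 1) by norm_num,
        show (-1 + 4*n + 2)/4 = n by omega, show (4*n + 2 - -1)/4 = n by omega,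
        show (1 + 4*n + 2)/4 = n by omega, show (4*n + 2 - 1)/4 = n by omega, smul_add]
      abel
    rw [τE_wE h₁ h₂, dE_wE (by omega), τE_zE (by omega), τE_zE (by omega),
      show -(k - 1) = -k + 1 by ring, show -(k + 1) = -k - 1 by ring,
      show 4*n + 2 - -k = k + 4*n + 2 by ring, show -k + 4*n + 2 = 4*n + 2 - k by ring,
      add_comm]
  | hz l hl =>
    rw [dE_zE, τE_zero]
    by_cases h₀ : l = 0
    · subst h₀
      rw [τE_zE_zero hn, map_add, dE_zE, dE_sE_t, add_zero]
    rw [τE_zE h₀, dE_zE]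
  | hs s =>
    cases s
    · rw [τE_sE_r0, dE_sE_r0, τE_add, τE_smul, τE_smul, map_pow, map_pow, swUV_UU, swUV_VV,
        τE_sE_rm, τE_sE_rp, add_comm]
    · rw [τE_sE_rm, dE_sE_rp, dE_sE_rm, τE_smul, map_pow, swUV_UU, τE_sE_t]
    · rw [τE_sE_rp, dE_sE_rp, dE_sE_rm, τE_smul, map_pow, swUV_VV, τE_sE_t]
    · rw [τE_sE_t, dE_sE_t, τE_zero]

lemma IsDGrading.gz_neg {gw gz : ℤ → ℤ × ℤ} (h : IsDGrading n gw gz) {l : ℤ}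
    (hl : l % 2 = 0 ∧ -(4*n - 2) ≤ l ∧ l ≤ 4*n - 2) : gz (-l) = (gz l).swap := by
  obtain ⟨hbot, htop, hk⟩ := h
  have key : ∀ j : ℕ, (j : ℤ) ≤ 4*n - 2 →
      (gz (4*n - 2 - 2*j)).1 = (gz (-(4*n - 2 - 2*j))).2 := by
    intro j
    induction j with
    | zero =>
      intro _
      rw [show -(4*n - 2 - 2*((0 : ℕ) : ℤ)) = -(4*n) + 2 by push_cast; ring,
        show 4*n - 2 - 2*((0 : ℕ) : ℤ) = 4*n - 2 by push_cast; ring, hbot, htop]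
    | succ j ih =>
      intro hj
      push_cast at hj ⊢
      have ih := ih (by omega)
      obtain ⟨a₁, a₂⟩ := hk (4*n - 3 - 2*j) (by omega) (by omega) (by omega)
      obtain ⟨b₁, b₂⟩ := hk (-(4*n - 3 - 2*j)) (by omega) (by omega) (by omega)
      rw [show 4*n - 3 - 2*(j : ℤ) - 1 = 4*n - 2 - 2*(j + 1) by ring] at a₁
      rw [show 4*n - 3 - 2*(j : ℤ) + 1 = 4*n - 2 - 2*j by ring] at a₂
      rw [show -(4*n - 3 - 2*(j : ℤ)) - 1 = -(4*n - 2 - 2*j) by ring] at b₁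
      rw [show -(4*n - 3 - 2*(j : ℤ)) + 1 = -(4*n - 2 - 2*(j + 1)) by ring] at b₂
      rw [a₂, b₁] at ih
      rw [a₁, b₂]
      rw [show -(4*n - 3 - 2*(j : ℤ)) + 4*n + 2 = 4*n + 2 - (4*n - 3 - 2*j) by ring] at ih
      dsimp only at ih ⊢
      omega
  have key' : ∀ l : ℤ, l % 2 = 0 → -(4*n - 2) ≤ l → l ≤ 4*n - 2 → (gz l).1 = (gz (-l)).2 := by
    intro l h₁ h₂ h₃
    have := key ((4*n - 2 - l)/2).toNat (by omega)
    rwa [show 4*n - 2 - 2*((((4*n - 2 - l)/2).toNat : ℕ) : ℤ) = l by omega] at this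
  refine Prod.ext ?_ ?_
  · simpa using key' (-l) (by omega) (by omega) (by omega)
  · exact (key' l hl.1 hl.2.1 hl.2.2).symm

lemma IsDGrading.gw_neg {gw gz : ℤ → ℤ × ℤ} (h : IsDGrading n gw gz) {k : ℤ}
    (hk : k % 2 = 1 ∧ -(4*n - 3) ≤ k ∧ k ≤ 4*n - 3) : gw (-k) = (gw k).swap := by
  have hz := h.gz_neg (l := k - 1) (by omega)
  obtain ⟨a, -⟩ := h.2.2 k hk.1 hk.2.1 hk.2.2
  obtain ⟨-, b⟩ := h.2.2 (-k) (by omega) (by omega) (by omega)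
  rw [show -(k - 1) = -k + 1 by ring, a, b, Prod.swap_prod_mk,
    show 4*n + 2 - -k = k + 4*n + 2 by ring, Prod.mk.injEq] at hz
  refine Prod.ext ?_ ?_
  · simp only [Prod.fst_swap]; omega
  · simp only [Prod.snd_swap]; omega

lemma homog_wE {gw gz : ℤ → ℤ × ℤ} {gS : SB → ℤ × ℤ} {k : ℤ} {d : ℤ × ℤ} (h : gw k = d) :
    Homog (grE gw gz gS) d (wE n k) := by
  unfold wE
  split_ifs
  · exact Homog.single_one h
  · exact Homog.zero _ _

lemma homog_zE {gw gz : ℤ → ℤ × ℤ} {gS : SB → ℤ × ℤ} {l : ℤ} {d : ℤ × ℤ} (h : gz l = d) :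
    Homog (grE gw gz gS) d (zE n l) := by
  unfold zE
  split_ifs
  · exact Homog.single_one h
  · exact Homog.zero _ _

lemma homog_sE {gw gz : ℤ → ℤ × ℤ} {gS : SB → ℤ × ℤ} {s : SB} {d : ℤ × ℤ} (h : gS s = d) :
    Homog (grE gw gz gS) d (sE n s) :=
  Homog.single_one h

lemma homog_τE (hn : 1 ≤ n) {gw gz : ℤ → ℤ × ℤ} {gS : SB → ℤ × ℤ} (hD : IsDGrading n gw gz)
    (hS : IsSGrading n gz gS) {d : ℤ × ℤ} {ξ : Ec n} (hξ : Homog (grE gw gz gS) d ξ) :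
    Homog (grE gw gz gS) d.swap (τE n ξ) := by
  have hz₀ : gz 0 = (gz 0).swap := hD.gz_neg (l := 0) (by omega)
  have hz₀' : (gz 0).1 = (gz 0).2 := congrArg Prod.fst hz₀
  have hw₁ : gw (-1) = (gw 1).swap := hD.gw_neg (by omega)
  have hw₁' : gw 1 = (gw (-1)).swap := by rw [hw₁, Prod.swap_swap]
  obtain ⟨ht, hm₁, hm₂, hp₁, hp₂, h0₁, h0₂, h0₃, h0₄⟩ := hS
  have ht₁ := congrArg Prod.fst ht
  have ht₂ := congrArg Prod.snd ht
  have hrm : gS SB.rm = gw (-1) := by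
    have h := (hD.2.2 (-1) (by omega) (by omega) (by omega)).2
    rw [show (-1 : ℤ) + 1 = 0 by norm_num, show (4*n + 2 - -1)/4 = n by omega] at h
    have e₁ := congrArg Prod.fst h
    have e₂ := congrArg Prod.snd h
    dsimp only at e₁ e₂
    exact Prod.ext (by omega) (by omega)
  have hrp : gS SB.rp = gw 1 := by
    have h := (hD.2.2 1 (by omega) (by omega) (by omega)).1
    rw [show (1 : ℤ) - 1 = 0 by norm_num, show (1 + 4*n + 2)/4 = n by omega] at h
    have e₁ := congrArg Prod.fst h
    have e₂ := congrArg Prod.snd h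
    dsimp only at e₁ e₂
    exact Prod.ext (by omega) (by omega)
  refine homog_skewExt ?_ hξ
  rintro ((⟨k, hk⟩ | ⟨l, hl⟩) | s)
  · dsimp only [grE]
    split_ifs with h₁ h₂
    · subst h₁
      exact (homog_wE hw₁').add (homog_sE (hrp.trans hw₁'))
    · subst h₂
      exact (homog_wE hw₁).add (homog_sE (hrm.trans hw₁))
    · exact homog_wE (hD.gw_neg hk)
  · dsimp only [grE]
    split_ifs with h₀
    · subst h₀
      exact (homog_zE hz₀).add (homog_sE (ht.trans hz₀))
    · exact homog_zE (hD.gz_neg hl)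
  · cases s
    · exact homog_sE (Prod.ext (show _ = (gS SB.r0).2 by omega) (show _ = (gS SB.r0).1 by omega))
    · exact homog_sE (by change _ = (gS SB.rm).swap; rw [hrm, hrp, hw₁'])
    · exact homog_sE (by change _ = (gS SB.rp).swap; rw [hrm, hrp, hw₁])
    · exact homog_sE (by change _ = (gS SB.t).swap; rw [ht]; exact hz₀)

end TauE

/-- For every integer `n ≥ 1`, the map `τ_E` on `E_n` is a
skew-graded, skew-equivariant chain map (`τ_E ∘ ∂ = ∂ ∘ τ_E`) and satisfies
`τ_E ∘ τ_E = id`. -/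
theorem tauE_is_skew_graded_skew_equivariant_chain_involution (n : ℤ) (hn : 1 ≤ n) :
    -- `τ_E` is additive and skew-equivariant:
    (∀ ξ η : Ec n, τE n (ξ + η) = τE n ξ + τE n η) ∧
    (∀ (p : R2) (ξ : Ec n), τE n (p • ξ) = swUV p • τE n ξ) ∧
    -- `τ_E` is skew-graded:
    (∀ gw gz gS, IsDGrading n gw gz → IsSGrading n gz gS →
      ∀ (ξ : Ec n) (deg : ℤ × ℤ), Homog (grE gw gz gS) deg ξ →
        Homog (grE gw gz gS) (deg.2, deg.1) (τE n ξ)) ∧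
    -- `τ_E` is a chain map:
    (∀ ξ : Ec n, τE n (dE n ξ) = dE n (τE n ξ)) ∧
    -- `τ_E ∘ τ_E = id`:
    (∀ ξ : Ec n, τE n (τE n ξ) = ξ) := by
  exact ⟨τE_add, τE_smul, fun gw gz gS hD hS ξ deg hξ => homog_τE hn hD hS hξ, τE_dE hn,
    τE_τE hn⟩
end

section
/- Fix an integer n ≥ 1 and consider the dual staircase complex C_n^∨. For every odd integer k with |k| ≤ 4n−3, among all pairs (p,q) with p even, |p| ≤ 2n−2, q odd, |q| ≤ 2n−1 and p + q = k, both quantities gr_U(x^∨_p) + gr_U(y^∨_q) and gr_V(x^∨_p) + gr_V(y^∨_q) attain their minimum at the difference-minimizing pair. Similarly, for every even integer ℓ with |ℓ| ≤ 4n−2, among all pairs (p,q) with p, q odd, |p|, |q| ≤ 2n−1 and p + q = ℓ, both quantities gr_U(y^∨_p) + gr_U(y^∨_q) and gr_V(y^∨_p) + gr_V(y^∨_q) attain their minimum at the difference-minimizing pair(s). -/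
/-- The defining conditions on the bigrading of the staircase complex `C_n` over
`R = F₂[U,V]`:  `gx k` (resp. `gy ℓ`) is the bigrading `(gr_U, gr_V)` of the generator
`x_k` (`k` even, `|k| ≤ 2n−2`), resp. `y_ℓ` (`ℓ` odd, `|ℓ| ≤ 2n−1`).  The differential
`∂x_k = V^{(k+2n)/2} y_{k−1} + U^{(2n−k)/2} y_{k+1}` has bidegree `(−1,−1)`, and the
bigrading is normalized by `gr_V(y_{−2n+1}) = gr_U(y_{2n−1}) = 0`.  The dual complex
`C_n^∨` has `gr(x_k^∨) = −gx k` and `gr(y_ℓ^∨) = −gy ℓ`. -/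
def IsCGrading (n : ℤ) (gx gy : ℤ → ℤ × ℤ) : Prop :=
  (gy (-(2*n) + 1)).2 = 0 ∧ (gy (2*n - 1)).1 = 0 ∧
  ∀ k : ℤ, k % 2 = 0 → -(2*n - 2) ≤ k → k ≤ 2*n - 2 →
    gy (k - 1) = ((gx k).1 - 1, (gx k).2 - 1 + (k + 2*n)) ∧
    gy (k + 1) = ((gx k).1 - 1 + (2*n - k), (gx k).2 - 1)

/-- For `k` odd, the pair `(p,q)` with `p` even, `q` odd, `p + q = k` is
difference-minimizing. -/
def DiffMinOdd (k p q : ℤ) : Prop :=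
  (k % 4 = 1 ∧ p = (k - 1)/2 ∧ q = (k + 1)/2) ∨
  (k % 4 = 3 ∧ p = (k + 1)/2 ∧ q = (k - 1)/2)

/-- For `ℓ` even, the pair `(p,q)` with `p, q` odd, `p + q = ℓ` is
difference-minimizing. -/
def DiffMinEven (l p q : ℤ) : Prop :=
  (l % 4 = 2 ∧ p = l/2 ∧ q = l/2) ∨
  (l % 4 = 0 ∧ ((p = l/2 - 1 ∧ q = l/2 + 1) ∨ (p = l/2 + 1 ∧ q = l/2 - 1)))

namespace IsCGrading

variable {n : ℤ} {gx gy : ℤ → ℤ × ℤ}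

theorem four_mul_gy_fst (hC : IsCGrading n gx gy) {l : ℤ} (hl : l % 2 = 1)
    (hl₁ : -(2*n - 1) ≤ l) (hl₂ : l ≤ 2*n - 1) :
    4 * (gy l).1 = 1 - (2*n - l)^2 := by
  obtain ⟨-, h0, hstep⟩ := hC
  have key : ∀ j : ℕ, (j : ℤ) ≤ 2*n - 1 →
      4 * (gy (2*n - 1 - 2*j)).1 = 1 - (1 + 2*(j : ℤ))^2 := by
    intro j
    induction j with
    | zero => intro _; simp [h0]
    | succ j ih =>
      intro hj
      push_cast at hj ⊢
      obtain ⟨h1, h2⟩ := hstep (2*n - 2 - 2*j) (by omega) (by omega) (by omega)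
      have ih := ih (by omega)
      rw [show 2*n - 2 - 2*(j : ℤ) + 1 = 2*n - 1 - 2*j by ring] at h2
      rw [show 2*n - 2 - 2*(j : ℤ) - 1 = 2*n - 1 - 2*(j + 1) by ring] at h1
      rw [h2] at ih
      rw [h1]
      dsimp only at ih ⊢
      linarith
  obtain ⟨j, hj⟩ := Int.eq_ofNat_of_zero_le (a := (2*n - 1 - l) / 2) (by omega)
  have h := key j (by omega)
  rwa [show 2*n - 1 - 2*(j : ℤ) = l by omega, show 1 + 2*(j : ℤ) = 2*n - l by omega] at h

theorem four_mul_gy_snd (hC : IsCGrading n gx gy) {l : ℤ} (hl : l % 2 = 1)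
    (hl₁ : -(2*n - 1) ≤ l) (hl₂ : l ≤ 2*n - 1) :
    4 * (gy l).2 = 1 - (2*n + l)^2 := by
  obtain ⟨h0, -, hstep⟩ := hC
  have key : ∀ j : ℕ, (j : ℤ) ≤ 2*n - 1 →
      4 * (gy (-(2*n) + 1 + 2*j)).2 = 1 - (1 + 2*(j : ℤ))^2 := by
    intro j
    induction j with
    | zero => intro _; simp [h0]
    | succ j ih =>
      intro hj
      push_cast at hj ⊢
      obtain ⟨h1, h2⟩ := hstep (-(2*n) + 2 + 2*j) (by omega) (by omega) (by omega)
      have ih := ih (by omega)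
      rw [show -(2*n) + 2 + 2*(j : ℤ) + 1 = -(2*n) + 1 + 2*(j + 1) by ring] at h2
      rw [show -(2*n) + 2 + 2*(j : ℤ) - 1 = -(2*n) + 1 + 2*j by ring] at h1
      rw [h1] at ih
      rw [h2]
      dsimp only at ih ⊢
      linarith
  obtain ⟨j, hj⟩ := Int.eq_ofNat_of_zero_le (a := (2*n - 1 + l) / 2) (by omega)
  have h := key j (by omega)
  rwa [show -(2*n) + 1 + 2*(j : ℤ) = l by omega, show 1 + 2*(j : ℤ) = 2*n + l by omega] at h

theorem four_mul_gx_fst (hC : IsCGrading n gx gy) {k : ℤ} (hk : k % 2 = 0)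
    (hk₁ : -(2*n - 2) ≤ k) (hk₂ : k ≤ 2*n - 2) :
    4 * (gx k).1 = 5 - (2*n - k + 1)^2 := by
  have h := hC.four_mul_gy_fst (l := k - 1) (by omega) (by omega) (by omega)
  rw [(hC.2.2 k hk hk₁ hk₂).1] at h
  dsimp only at h
  linarith

theorem four_mul_gx_snd (hC : IsCGrading n gx gy) {k : ℤ} (hk : k % 2 = 0)
    (hk₁ : -(2*n - 2) ≤ k) (hk₂ : k ≤ 2*n - 2) :
    4 * (gx k).2 = 5 - (2*n + k + 1)^2 := by
  have h := hC.four_mul_gy_snd (l := k + 1) (by omega) (by omega) (by omega)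
  rw [(hC.2.2 k hk hk₁ hk₂).2] at h
  dsimp only at h
  linarith

end IsCGrading

/-- Among pairs of integers with a fixed sum, a smaller difference gives a smaller sum of
squares. -/
theorem sq_add_sq_le_of_abs_sub_le {u v u₀ v₀ : ℤ} (hs : u₀ + v₀ = u + v)
    (hd : |u₀ - v₀| ≤ |u - v|) : u₀^2 + v₀^2 ≤ u^2 + v^2 := by
  have h := sq_le_sq.mpr hd
  have hs2 : (u₀ + v₀)^2 = (u + v)^2 := by rw [hs]
  linarith

/-- In the dual staircase complex `C_n^∨`:  for every odd `k` with
`|k| ≤ 4n−3`, among all pairs `(p,q)` with `p` even, `|p| ≤ 2n−2`, `q` odd,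
`|q| ≤ 2n−1`, `p + q = k`, both `gr_U(x^∨_p) + gr_U(y^∨_q)` and
`gr_V(x^∨_p) + gr_V(y^∨_q)` attain their minimum at the difference-minimizing pair
(which is in particular such a pair); likewise for every even `ℓ` with `|ℓ| ≤ 4n−2`,
among all pairs `(p,q)` with `p, q` odd, `|p|, |q| ≤ 2n−1, p + q = ℓ`, both
`gr_U(y^∨_p) + gr_U(y^∨_q)` and `gr_V(y^∨_p) + gr_V(y^∨_q)` attain their minimum at
the difference-minimizing pair(s). -/
theorem dual_grading_minimized_at_difference_minimizing_pairs
    (n : ℤ) (hn : 1 ≤ n) (gx gy : ℤ → ℤ × ℤ) (hC : IsCGrading n gx gy) :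
    (∀ k : ℤ, k % 2 = 1 → -(4*n - 3) ≤ k → k ≤ 4*n - 3 →
      ∀ p₀ q₀ : ℤ, DiffMinOdd k p₀ q₀ →
        (p₀ % 2 = 0 ∧ -(2*n - 2) ≤ p₀ ∧ p₀ ≤ 2*n - 2 ∧
         q₀ % 2 = 1 ∧ -(2*n - 1) ≤ q₀ ∧ q₀ ≤ 2*n - 1 ∧ p₀ + q₀ = k) ∧
        (∀ p q : ℤ, p % 2 = 0 → -(2*n - 2) ≤ p → p ≤ 2*n - 2 →
          q % 2 = 1 → -(2*n - 1) ≤ q → q ≤ 2*n - 1 → p + q = k →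
          (-(gx p₀).1) + (-(gy q₀).1) ≤ (-(gx p).1) + (-(gy q).1) ∧
          (-(gx p₀).2) + (-(gy q₀).2) ≤ (-(gx p).2) + (-(gy q).2))) ∧
    (∀ l : ℤ, l % 2 = 0 → -(4*n - 2) ≤ l → l ≤ 4*n - 2 →
      ∀ p₀ q₀ : ℤ, DiffMinEven l p₀ q₀ →
        (p₀ % 2 = 1 ∧ -(2*n - 1) ≤ p₀ ∧ p₀ ≤ 2*n - 1 ∧
         q₀ % 2 = 1 ∧ -(2*n - 1) ≤ q₀ ∧ q₀ ≤ 2*n - 1 ∧ p₀ + q₀ = l) ∧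
        (∀ p q : ℤ, p % 2 = 1 → -(2*n - 1) ≤ p → p ≤ 2*n - 1 →
          q % 2 = 1 → -(2*n - 1) ≤ q → q ≤ 2*n - 1 → p + q = l →
          (-(gy p₀).1) + (-(gy q₀).1) ≤ (-(gy p).1) + (-(gy q).1) ∧
          (-(gy p₀).2) + (-(gy q₀).2) ≤ (-(gy p).2) + (-(gy q).2))) := by
  refine ⟨fun k _ hk₁ hk₂ p₀ q₀ h₀ => ?_, fun l _ hl₁ hl₂ p₀ q₀ h₀ => ?_⟩
  · unfold DiffMinOdd at h₀
    have hr : p₀ % 2 = 0 ∧ -(2*n - 2) ≤ p₀ ∧ p₀ ≤ 2*n - 2 ∧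
         q₀ % 2 = 1 ∧ -(2*n - 1) ≤ q₀ ∧ q₀ ≤ 2*n - 1 ∧ p₀ + q₀ = k := by omega
    refine ⟨hr, fun p q hp hp₁ hp₂ hq hq₁ hq₂ hpq => ?_⟩
    obtain ⟨hp₀, hp₀₁, hp₀₂, hq₀, hq₀₁, hq₀₂, hpq₀⟩ := hr
    constructor
    · have := hC.four_mul_gx_fst hp₀ hp₀₁ hp₀₂
      have := hC.four_mul_gy_fst hq₀ hq₀₁ hq₀₂
      have := hC.four_mul_gx_fst hp hp₁ hp₂
      have := hC.four_mul_gy_fst hq hq₁ hq₂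
      have := sq_add_sq_le_of_abs_sub_le (u := 2*n - p + 1) (v := 2*n - q)
        (u₀ := 2*n - p₀ + 1) (v₀ := 2*n - q₀) (by omega) (by simp only [abs_eq_max_neg]; omega)
      linarith
    · have := hC.four_mul_gx_snd hp₀ hp₀₁ hp₀₂
      have := hC.four_mul_gy_snd hq₀ hq₀₁ hq₀₂
      have := hC.four_mul_gx_snd hp hp₁ hp₂
      have := hC.four_mul_gy_snd hq hq₁ hq₂
      have := sq_add_sq_le_of_abs_sub_le (u := 2*n + p + 1) (v := 2*n + q)
        (u₀ := 2*n + p₀ + 1) (v₀ := 2*n + q₀) (by omega) (by simp only [abs_eq_max_neg]; omega)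
      linarith
  · unfold DiffMinEven at h₀
    have hr : p₀ % 2 = 1 ∧ -(2*n - 1) ≤ p₀ ∧ p₀ ≤ 2*n - 1 ∧
         q₀ % 2 = 1 ∧ -(2*n - 1) ≤ q₀ ∧ q₀ ≤ 2*n - 1 ∧ p₀ + q₀ = l := by omega
    refine ⟨hr, fun p q hp hp₁ hp₂ hq hq₁ hq₂ hpq => ?_⟩
    obtain ⟨hp₀, hp₀₁, hp₀₂, hq₀, hq₀₁, hq₀₂, hpq₀⟩ := hr
    constructor
    · have := hC.four_mul_gy_fst hp₀ hp₀₁ hp₀₂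
      have := hC.four_mul_gy_fst hq₀ hq₀₁ hq₀₂
      have := hC.four_mul_gy_fst hp hp₁ hp₂
      have := hC.four_mul_gy_fst hq hq₁ hq₂
      have := sq_add_sq_le_of_abs_sub_le (u := 2*n - p) (v := 2*n - q)
        (u₀ := 2*n - p₀) (v₀ := 2*n - q₀) (by omega) (by simp only [abs_eq_max_neg]; omega)
      linarith
    · have := hC.four_mul_gy_snd hp₀ hp₀₁ hp₀₂
      have := hC.four_mul_gy_snd hq₀ hq₀₁ hq₀₂
      have := hC.four_mul_gy_snd hp hp₁ hp₂
      have := hC.four_mul_gy_snd hq hq₁ hq₂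
      have := sq_add_sq_le_of_abs_sub_le (u := 2*n + p) (v := 2*n + q)
        (u₀ := 2*n + p₀) (v₀ := 2*n + q₀) (by omega) (by simp only [abs_eq_max_neg]; omega)
      linarith
end

section
/- Fix an integer n ≥ 1. For every odd integer k with |k| ≤ 4n−3 and every difference-minimizing pair (p,q) with p even, q odd and p + q = k, the bigradings satisfy gr(w^∨_k) = gr(x^∨_p) + gr(y^∨_q) (equality of both components gr_U and gr_V), where w^∨_k is the dual basis element of the staircase complex D_n and x^∨_p, y^∨_q are dual basis elements of C_n. Similarly, for every even integer ℓ with |ℓ| ≤ 4n−2 and every difference-minimizing pair (p,q) with p, q odd and p + q = ℓ, we have gr(z^∨_ℓ) = gr(y^∨_p) + gr(y^∨_q). -/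
/-- Reflecting the index and exchanging `gr_U` with `gr_V` preserves gradings of `C_n`. -/
theorem IsCGrading.reflect {n : ℤ} {gx gy : ℤ → ℤ × ℤ} (h : IsCGrading n gx gy) :
    IsCGrading n (fun k => (gx (-k)).swap) (fun k => (gy (-k)).swap) := by
  obtain ⟨h1, h2, h3⟩ := h
  refine ⟨?_, ?_, fun k hk hl hu => ?_⟩
  · simpa [show -(-(2*n) + 1) = 2*n - 1 by ring] using h2
  · simpa [show -(2*n - 1) = -(2*n) + 1 by ring] using h1
  · obtain ⟨ha, hb⟩ := h3 (-k) (by omega) (by omega) (by omega)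
    constructor
    · simp only [show -(k - 1) = -k + 1 by ring, hb, Prod.swap, Prod.mk.injEq, true_and]
      ring
    · simp only [show -(k + 1) = -k - 1 by ring, ha, Prod.swap, Prod.mk.injEq, and_true]
      ring

/-- Reflecting the index and exchanging `gr_U` with `gr_V` preserves gradings of `D_n`. -/
theorem IsDGrading.reflect {n : ℤ} {gw gz : ℤ → ℤ × ℤ} (h : IsDGrading n gw gz) :
    IsDGrading n (fun k => (gw (-k)).swap) (fun k => (gz (-k)).swap) := by
  obtain ⟨h1, h2, h3⟩ := h
  refine ⟨?_, ?_, fun k hk hl hu => ?_⟩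
  · simpa [show -(-(4*n) + 2) = 4*n - 2 by ring] using h2
  · simpa [show -(4*n - 2) = -(4*n) + 2 by ring] using h1
  · obtain ⟨ha, hb⟩ := h3 (-k) (by omega) (by omega) (by omega)
    constructor
    · simp only [show -(k - 1) = -k + 1 by ring, hb, Prod.swap, Prod.mk.injEq, true_and]
      ring_nf
    · simp only [show -(k + 1) = -k - 1 by ring, ha, Prod.swap, Prod.mk.injEq, and_true]
      ring_nf

theorem DiffMinOdd.neg {k p q : ℤ} (h : DiffMinOdd k p q) : DiffMinOdd (-k) (-p) (-q) := by
  unfold DiffMinOdd at *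
  omega

theorem DiffMinEven.neg {l p q : ℤ} (h : DiffMinEven l p q) : DiffMinEven (-l) (-p) (-q) := by
  unfold DiffMinEven at *
  omega

theorem DiffMinOdd.succ_left {k p q : ℤ} (h : DiffMinOdd k p q) :
    DiffMinEven (k + 1) (p + 1) q := by
  unfold DiffMinOdd at h
  unfold DiffMinEven
  omega

theorem IsCGrading.gradingV_y {n : ℤ} {gx gy : ℤ → ℤ × ℤ} (h : IsCGrading n gx gy) (j : ℕ)
    (hj : (j : ℤ) ≤ 2*n - 1) : (gy (-(2*n) + 1 + 2*j)).2 = -(j*(j + 1) : ℤ) := by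
  induction j with
  | zero => simpa using h.1
  | succ j ih =>
    push_cast at hj ⊢
    have ih := ih (by omega)
    obtain ⟨ha, hb⟩ := h.2.2 (-(2*n) + 2 + 2*j) (by omega) (by omega) (by omega)
    rw [show -(2*n) + 2 + 2*(j : ℤ) - 1 = -(2*n) + 1 + 2*j by ring] at ha
    rw [show -(2*n) + 2 + 2*(j : ℤ) + 1 = -(2*n) + 1 + 2*(j + 1) by ring] at hb
    rw [ha] at ih
    rw [hb]
    dsimp only at ih ⊢
    linarith

theorem IsDGrading.gradingV_z_add_two {n : ℤ} {gw gz : ℤ → ℤ × ℤ} (h : IsDGrading n gw gz)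
    {l : ℤ} (hl : l % 2 = 0) (hlb : -(4*n) + 2 ≤ l) (hub : l ≤ 4*n - 4) :
    (gz (l + 2)).2 = (gz l).2 - 2*((l + 4*n + 3)/4) := by
  obtain ⟨ha, hb⟩ := h.2.2 (l + 1) (by omega) (by omega) (by omega)
  rw [show l + 1 - 1 = l by ring, show l + 1 + 4*n + 2 = l + 4*n + 3 by ring] at ha
  rw [show l + 1 + 1 = l + 2 by ring] at hb
  rw [ha, hb]
  ring

theorem IsDGrading.gradingV_z {n : ℤ} {gw gz : ℤ → ℤ × ℤ} (h : IsDGrading n gw gz) (j : ℕ)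
    (hj : (j : ℤ) ≤ 2*n - 1) : (gz (-(4*n) + 2 + 4*j)).2 = -(2*j*(j + 1) : ℤ) := by
  induction j with
  | zero => simpa using h.1
  | succ j ih =>
    push_cast at hj ⊢
    have ih := ih (by omega)
    have h1 := h.gradingV_z_add_two (l := -(4*n) + 2 + 4*j) (by omega) (by omega) (by omega)
    have h2 := h.gradingV_z_add_two (l := -(4*n) + 2 + 4*j + 2) (by omega) (by omega) (by omega)
    rw [show (-(4*n) + 2 + 4*(j : ℤ) + 4*n + 3)/4 = j + 1 by omega] at h1
    rw [show (-(4*n) + 2 + 4*(j : ℤ) + 2 + 4*n + 3)/4 = j + 1 by omega,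
      show -(4*n) + 2 + 4*(j : ℤ) + 2 + 2 = -(4*n) + 2 + 4*(j + 1) by ring] at h2
    linarith

theorem gradingV_z_eq_add {n : ℤ} {gx gy gw gz : ℤ → ℤ × ℤ} (hC : IsCGrading n gx gy)
    (hD : IsDGrading n gw gz) {l p q : ℤ} (hlb : -(4*n - 2) ≤ l) (hub : l ≤ 4*n - 2)
    (h : DiffMinEven l p q) : (gz l).2 = (gy p).2 + (gy q).2 := by
  obtain ⟨j, hj⟩ : ∃ j : ℕ, (j : ℤ) = (l + 4*n - 2)/4 := ⟨_, Int.toNat_of_nonneg (by omega)⟩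
  have hz := hD.gradingV_z j (by omega)
  have hy := hC.gradingV_y j (by omega)
  rcases h with ⟨hl, rfl, rfl⟩ | ⟨hl, hpq⟩
  · rw [show l/2 = -(2*n) + 1 + 2*j by omega, hy, show l = -(4*n) + 2 + 4*j by omega, hz]
    ring
  · have hz' := hD.gradingV_z_add_two (l := -(4*n) + 2 + 4*j) (by omega) (by omega) (by omega)
    rw [show (-(4*n) + 2 + 4*(j : ℤ) + 4*n + 3)/4 = j + 1 by omega, hz] at hz'
    have hy' := hC.gradingV_y (j + 1) (by omega)
    push_cast at hy'
    rw [show l = -(4*n) + 2 + 4*j + 2 by omega, hz']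
    rcases hpq with ⟨rfl, rfl⟩ | ⟨rfl, rfl⟩ <;>
    · rw [show l/2 - 1 = -(2*n) + 1 + 2*j by omega,
        show l/2 + 1 = -(2*n) + 1 + 2*(j + 1) by omega, hy, hy']
      ring

theorem gradingV_w_eq_add {n : ℤ} {gx gy gw gz : ℤ → ℤ × ℤ} (hC : IsCGrading n gx gy)
    (hD : IsDGrading n gw gz) {k p q : ℤ} (hlb : -(4*n - 3) ≤ k) (hub : k ≤ 4*n - 3)
    (h : DiffMinOdd k p q) : (gw k).2 = (gx p).2 + (gy q).2 := by
  have hz := gradingV_z_eq_add hC hD (by omega) (by omega) h.succ_left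
  unfold DiffMinOdd at h
  rw [(hD.2.2 k (by omega) hlb hub).2, (hC.2.2 p (by omega) (by omega) (by omega)).2] at hz
  dsimp only at hz
  linarith

/-- For every odd `k` with `|k| ≤ 4n−3` and every
difference-minimizing pair `(p,q)` with `p + q = k`,
`gr(w^∨_k) = gr(x^∨_p) + gr(y^∨_q)` in both components; for every even `ℓ` with
`|ℓ| ≤ 4n−2` and every difference-minimizing pair `(p,q)` with `p + q = ℓ`,
`gr(z^∨_ℓ) = gr(y^∨_p) + gr(y^∨_q)`.  (Dual gradings are the negatives of the
gradings of the original complexes.) -/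
theorem dual_grading_of_D_equals_sum_at_difference_minimizing_pairs
    (n : ℤ) (hn : 1 ≤ n)
    (gx gy : ℤ → ℤ × ℤ) (hC : IsCGrading n gx gy)
    (gw gz : ℤ → ℤ × ℤ) (hD : IsDGrading n gw gz) :
    (∀ k : ℤ, k % 2 = 1 → -(4*n - 3) ≤ k → k ≤ 4*n - 3 →
      ∀ p q : ℤ, DiffMinOdd k p q →
        (-(gw k).1 = (-(gx p).1) + (-(gy q).1)) ∧
        (-(gw k).2 = (-(gx p).2) + (-(gy q).2))) ∧
    (∀ l : ℤ, l % 2 = 0 → -(4*n - 2) ≤ l → l ≤ 4*n - 2 →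
      ∀ p q : ℤ, DiffMinEven l p q →
        (-(gz l).1 = (-(gy p).1) + (-(gy q).1)) ∧
        (-(gz l).2 = (-(gy p).2) + (-(gy q).2))) := by
  constructor
  · intro k _ hlb hub p q h
    have hV := gradingV_w_eq_add hC hD hlb hub h
    have hU := gradingV_w_eq_add hC.reflect hD.reflect (by omega) (by omega) h.neg
    simp only [neg_neg, Prod.snd_swap] at hU
    constructor <;> linarith
  · intro l _ hlb hub p q h
    have hV := gradingV_z_eq_add hC hD hlb hub h
    have hU := gradingV_z_eq_add hC.reflect hD.reflect (by omega) (by omega) h.neg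
    simp only [neg_neg, Prod.snd_swap] at hU
    constructor <;> linarith
end
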